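/- Let Z ⊆ ℝ^d be an open convex set, let D ⊆ Z be a countable dense subset, let h : Z → ℝ be convex, and let (Ω, F, ℙ) be a probability space. Suppose (h_n)_{n∈ℕ} is a sequence of random functions h_n : Ω × Z → ℝ such that h_n(ω, ·) is convex on Z for every ω and every n, and for each z ∈ D it holds ℙ-almost surely that h_n(·, z) → h(z) as n → ∞. Then ℙ-almost surely, h_n(ω, ·) converges to h uniformly on every compact subset of Z. -/

import Mathlib

open Filter MeasureTheory ProbabilityTheory

section ConvexPointwise

variable {E : Type*} [NormedAddCommGroup E] [NormedSpace ℝ E] {Z D : Set E}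
  {g : ℕ → E → ℝ} {h : E → ℝ}

/-- Convex functions that are eventually bounded above at each point of a set are eventually
bounded above at each point of its convex hull. -/
theorem exists_eventually_le_of_mem_convexHull (hg : ∀ n, ConvexOn ℝ Z (g n)) (hDZ : D ⊆ Z)
    (hb : ∀ z ∈ D, ∃ M, ∀ᶠ n in atTop, g n z ≤ M) {z : E} (hz : z ∈ convexHull ℝ D) :
    ∃ M, ∀ᶠ n in atTop, g n z ≤ M := by
  have hconv : Convex ℝ {z | z ∈ Z ∧ ∃ M, ∀ᶠ n in atTop, g n z ≤ M} := by
    rintro x ⟨hx, M, hM⟩ y ⟨hy, N, hN⟩ a b ha hb hab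
    refine ⟨(hg 0).1 hx hy ha hb hab, a * M + b * N, ?_⟩
    filter_upwards [hM, hN] with n h₁ h₂
    have := (hg n).2 hx hy ha hb hab
    simp only [smul_eq_mul] at this
    nlinarith [mul_le_mul_of_nonneg_left h₁ ha, mul_le_mul_of_nonneg_left h₂ hb]
  have hsub : D ⊆ {z | z ∈ Z ∧ ∃ M, ∀ᶠ n in atTop, g n z ≤ M} := fun z hz => ⟨hDZ hz, hb z hz⟩
  exact (convexHull_min hsub hconv hz).2

variable [FiniteDimensional ℝ E]

/-- An open set is contained in the convex hull of any set whose closure contains it. -/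
theorem IsOpen.subset_convexHull_of_subset_closure (hZ : IsOpen Z) (hD : Z ⊆ closure D) :
    Z ⊆ convexHull ℝ D := by
  rcases Z.eq_empty_or_nonempty with rfl | hne
  · exact Set.empty_subset _
  have hspan : affineSpan ℝ D = ⊤ := by
    rw [eq_top_iff, ← hZ.affineSpan_eq_top hne, affineSpan_le]
    exact hD.trans (closure_minimal (subset_affineSpan ℝ D)
      (affineSpan ℝ D).closed_of_finiteDimensional)
  have hint := interior_convexHull_nonempty_iff_affineSpan_eq_top.2 hspan
  have hsub : Z ⊆ interior (closure (convexHull ℝ D)) :=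
    interior_maximal (hD.trans (closure_mono (subset_convexHull ℝ D))) hZ
  rw [(convex_convexHull ℝ D).interior_closure_eq_interior_of_nonempty_interior hint] at hsub
  exact hsub.trans interior_subset

/-- Convex functions on an open set that are eventually bounded above at each point are eventually
uniformly bounded above near each point. -/
theorem exists_eventually_le_nhds (hZ : IsOpen Z) (hg : ∀ n, ConvexOn ℝ Z (g n))
    (hb : ∀ z ∈ Z, ∃ M, ∀ᶠ n in atTop, g n z ≤ M) {x : E} (hx : x ∈ Z) :
    ∃ M, ∃ U ∈ nhds x, ∀ᶠ n in atTop, ∀ y ∈ U, g n y ≤ M := by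
  obtain ⟨b, hxb, hbZ⟩ := exists_mem_interior_convexHull_affineBasis (hZ.mem_nhds hx)
  have hbZ' : ∀ i, b i ∈ Z := fun i => hbZ (subset_convexHull ℝ _ (Set.mem_range_self i))
  choose M hM using fun i => hb (b i) (hbZ' i)
  obtain ⟨C, hC⟩ := (Set.finite_range M).bddAbove
  refine ⟨C, _, mem_interior_iff_mem_nhds.1 hxb, ?_⟩
  filter_upwards [eventually_all.2 hM] with n hn y hy
  refine (convexHull_min ?_ ((hg n).convex_le C) hy).2
  rintro _ ⟨i, rfl⟩
  exact ⟨hbZ' i, (hn i).trans (hC (Set.mem_range_self i))⟩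

/-- Convex functions on an open set that converge on a dense subset are eventually uniformly
Lipschitz near each point. -/
theorem exists_eventually_lipschitzOnWith_ball (hZ : IsOpen Z) (hg : ∀ n, ConvexOn ℝ Z (g n))
    (hDZ : D ⊆ Z) (hD : Z ⊆ closure D)
    (hlim : ∀ z ∈ D, Tendsto (fun n => g n z) atTop (nhds (h z))) {x : E} (hx : x ∈ Z) :
    ∃ r > 0, ∃ K, ∀ᶠ n in atTop, LipschitzOnWith K (g n) (Metric.ball x r) := by
  have hb : ∀ z ∈ Z, ∃ M, ∀ᶠ n in atTop, g n z ≤ M := fun z hz =>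
    exists_eventually_le_of_mem_convexHull hg hDZ
      (fun z hz => ⟨h z + 1, (hlim z hz).eventually_le_const (lt_add_one _)⟩)
      (hZ.subset_convexHull_of_subset_closure hD hz)
  obtain ⟨M, U, hU, hM⟩ := exists_eventually_le_nhds hZ hg hb hx
  obtain ⟨ρ, hρ, hρU⟩ := Metric.mem_nhds_iff.1 (inter_mem hU (hZ.mem_nhds hx))
  obtain ⟨r, hr, rfl⟩ : ∃ r > 0, ρ = 3 * r := ⟨ρ / 3, by positivity, by ring⟩
  obtain ⟨y, hyD, hy⟩ := Metric.mem_closure_iff.1 (hD hx) (r / 2) (by positivity)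
  have hsub : Metric.ball x (2 * r) ⊆ Metric.ball x (3 * r) :=
    Metric.ball_subset_ball (by linarith)
  refine ⟨2 * r - r, by linarith, (2 * max M (M - 2 * (h y - 1)) / r).toNNReal, ?_⟩
  filter_upwards [hM, (hlim y hyD).eventually_const_le (sub_one_lt _)] with n hn hny
  refine ((hg n).subset (fun z hz => (hρU (hsub hz)).2)
    (convex_ball x _)).lipschitzOnWith_of_abs_le hr fun z hz => ?_
  have hw : (2 : ℝ) • y - z ∈ Metric.ball x (3 * r) := by
    rw [dist_eq_norm] at hy hz
    rw [mem_ball_iff_norm]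
    have heq : (2 : ℝ) • y - z - x = -((2 : ℝ) • (x - y) + (z - x)) := by module
    rw [heq, norm_neg]
    refine (norm_add_le _ _).trans_lt ?_
    rw [norm_smul, Real.norm_two]
    linarith
  have hmid := (hg n).2 (hρU (hsub hz)).2 (hρU hw).2 (one_half_pos (α := ℝ)).le
    one_half_pos.le (add_halves 1)
  rw [show (1 / 2 : ℝ) • z + (1 / 2 : ℝ) • ((2 : ℝ) • y - z) = y by module] at hmid
  simp only [smul_eq_mul] at hmid
  have h₁ := hn z (hρU (hsub hz)).1
  have h₂ := hn _ (hρU hw).1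
  rw [abs_le]
  constructor
  · linarith [le_max_right M (M - 2 * (h y - 1))]
  · exact h₁.trans (le_max_left _ _)

/-- Convex functions on an open set that converge on a dense subset to a continuous function
converge locally uniformly. -/
theorem tendstoLocallyUniformlyOn_of_convexOn (hZ : IsOpen Z) (hg : ∀ n, ConvexOn ℝ Z (g n))
    (hDZ : D ⊆ Z) (hD : Z ⊆ closure D) (hh : ContinuousOn h Z)
    (hlim : ∀ z ∈ D, Tendsto (fun n => g n z) atTop (nhds (h z))) :
    TendstoLocallyUniformlyOn g h atTop Z := by
  rw [Metric.tendstoLocallyUniformlyOn_iff]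
  intro ε hε x hx
  obtain ⟨r, hr, K, hK⟩ := exists_eventually_lipschitzOnWith_ball hZ hg hDZ hD hlim hx
  obtain ⟨s, hs, hsh⟩ := Metric.continuousAt_iff.1 (hh.continuousAt (hZ.mem_nhds hx)) (ε / 8)
    (by positivity)
  obtain ⟨δ, hδ, hδr, hδs, hδK⟩ : ∃ δ > 0, δ ≤ r ∧ δ ≤ s ∧ K * (2 * δ) ≤ ε / 4 := by
    refine ⟨min (min r s) (ε / (8 * (K + 1))), by positivity,
      (min_le_left _ _).trans (min_le_left _ _), (min_le_left _ _).trans (min_le_right _ _), ?_⟩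
    calc (K : ℝ) * (2 * min (min r s) (ε / (8 * (K + 1))))
        ≤ (K + 1) * (2 * (ε / (8 * (K + 1)))) := by
          gcongr
          · linarith
          · exact min_le_right _ _
      _ = ε / 4 := by field_simp; norm_num
  obtain ⟨y, hyD, hxy⟩ := Metric.mem_closure_iff.1 (hD hx) δ hδ
  rw [dist_comm] at hxy
  refine ⟨Metric.ball x δ, mem_nhdsWithin_of_mem_nhds (Metric.ball_mem_nhds x hδ), ?_⟩
  filter_upwards [hK, Metric.tendsto_nhds.1 (hlim y hyD) (ε / 4) (by positivity)]
    with n hKn hyn z hz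
  rw [Metric.mem_ball] at hz
  have h₁ := hsh (hz.trans_le hδs)
  have h₂ := hsh (hxy.trans_le hδs)
  have h₃ : dist (g n y) (g n z) ≤ ε / 4 :=
    (hKn.dist_le_mul y (hxy.trans_le hδr) z (hz.trans_le hδr)).trans <| by
      refine le_trans ?_ hδK
      gcongr
      linarith [dist_triangle_right y z x]
  rw [dist_comm] at h₂ hyn
  linarith [dist_triangle (h z) (h x) (g n z), dist_triangle (h x) (h y) (g n z),
    dist_triangle (h y) (g n y) (g n z)]

end ConvexPointwise

/-- If `h_n : Ω × Z → ℝ` are random functions, convex in the second variable on the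
open convex set `Z ⊆ ℝ^d`, converging almost surely pointwise on a countable dense
subset `D` of `Z` to a convex function `h`, then almost surely `h_n(ω, ·) → h`
uniformly on every compact subset of `Z`. -/
theorem stmt_1 {d : ℕ} {Ω : Type*} [MeasureSpace Ω]
    [IsProbabilityMeasure (ℙ : Measure Ω)]
    (Z : Set (EuclideanSpace ℝ (Fin d)))
    (hZopen : IsOpen Z) (hZconv : Convex ℝ Z)
    (D : Set (EuclideanSpace ℝ (Fin d))) (hDZ : D ⊆ Z)
    (hDcount : D.Countable) (hDdense : Z ⊆ closure D)
    (h : EuclideanSpace ℝ (Fin d) → ℝ) (hconv : ConvexOn ℝ Z h)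
    (hn : ℕ → Ω → EuclideanSpace ℝ (Fin d) → ℝ)
    (hnconv : ∀ n ω, ConvexOn ℝ Z (hn n ω))
    (hpt : ∀ z ∈ D, ∀ᵐ ω ∂(ℙ : Measure Ω), Tendsto (fun n => hn n ω z) atTop (nhds (h z))) :
    ∀ᵐ ω ∂(ℙ : Measure Ω), ∀ K ⊆ Z, IsCompact K → TendstoUniformlyOn (fun n => hn n ω) h atTop K := by
  filter_upwards [(ae_ball_iff hDcount).2 hpt] with ω hω K hKZ hK
  exact (tendstoLocallyUniformlyOn_iff_forall_isCompact hZopen).1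
    (tendstoLocallyUniformlyOn_of_convexOn hZopen (fun n => hnconv n ω) hDZ hDdense
      (hconv.continuousOn hZopen) hω) K hKZ hK
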